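/- Fix an integer M ≥ 2 and let D* be the greedy optimal dictionary, whose failure probability at level N is P(fail*_N) = Σ_{T∈T_N} (|T| mod M)·p_T, where p_T is the common probability under P of the sequences in T. Then for every P ∈ P_k, P(fail*_N) decays exponentially fast with N: there exist constants C > 0 and 0 < ρ < 1 (depending on P and M) such that P(fail*_N) ≤ C·ρ^N for all N ≥ 1. -/

import Mathlib

open Finset

/-- `Finset.filter` with classical decidability. -/
noncomputable def sfilter {α : Type*} (p : α → Prop) (s : Finset α) : Finset α :=
  @Finset.filter α p (Classical.decPred p) s

/-- The finset of all strings of length `n` over the alphabet `A`. -/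
def lists (A : Type*) [Fintype A] [DecidableEq A] : ℕ → Finset (List A)
  | 0 => {[]}
  | n + 1 => Finset.image₂ List.cons Finset.univ (lists A n)

/-- Symbol at (0-indexed) integer position `j` of the string `x`, where negative
positions `-k, …, -1` are given by the fixed initial state `s0`. -/
def symL {A : Type*} [Inhabited A] (k : ℕ) (s0 : Fin k → A) (x : List A) (j : ℤ) : A :=
  if h : 0 ≤ j then
    (if h2 : j.toNat < x.length then x.get ⟨j.toNat, h2⟩ else default)
  else
    (if h3 : (j + k).toNat < k then s0 ⟨(j + k).toNat, h3⟩ else default)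

/-- The state (context of order `k`) preceding position `t` of the string `x`. -/
def ctxL {A : Type*} [Inhabited A] (k : ℕ) (s0 : Fin k → A) (x : List A)
    (t : ℕ) : Fin k → A :=
  fun i => symL k s0 x ((t : ℤ) - (k : ℤ) + (i : ℤ))

/-- `n_{sa}(x)`: number of occurrences of symbol `a` in state `s` within `x`. -/
noncomputable def countL {A : Type*} [Inhabited A] [DecidableEq A] (k : ℕ)
    (s0 : Fin k → A) (s : Fin k → A) (a : A) (x : List A) : ℕ :=
  (sfilter (fun t : Fin x.length => ctxL k s0 x t = s ∧ x.get t = a) Finset.univ).card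

/-- Two strings have the same `k`-th order type. -/
def sameTypeL {A : Type*} [Inhabited A] [DecidableEq A] (k : ℕ) (s0 : Fin k → A)
    (x y : List A) : Prop :=
  x.length = y.length ∧
    ∀ (s : Fin k → A) (a : A), countL k s0 s a x = countL k s0 s a y

/-- The type class `T(x)` as a finset of strings of length `|x|`. -/
noncomputable def typeClassL {A : Type*} [Fintype A] [DecidableEq A] [Inhabited A]
    (k : ℕ) (s0 : Fin k → A) (x : List A) : Finset (List A) :=
  sfilter (fun y => sameTypeL k s0 x y) (lists A x.length)

/-- Probability `P(x) = ∏_t p(x_t | state)` of the string `x`. -/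
noncomputable def seqProbL {A : Type*} [Inhabited A] (k : ℕ) (s0 : Fin k → A)
    (p : (Fin k → A) → A → ℝ) (x : List A) : ℝ :=
  ∏ t : Fin x.length, p (ctxL k s0 x t) (x.get t)

/-- `p` is a (strictly positive) `k`-th order Markov kernel. -/
def IsMarkov {A : Type*} [Fintype A] (k : ℕ) (p : (Fin k → A) → A → ℝ) : Prop :=
  (∀ s a, 0 < p s a) ∧ ∀ s, ∑ a : A, p s a = 1

/-- A prefix-free set of strings. -/
def PrefixFree {A : Type*} (D : Set (List A)) : Prop :=
  ∀ x ∈ D, ∀ y ∈ D, x <+: y → x = y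

/-- A complete dictionary: prefix-free, and every string either has a prefix in `D`
or is a prefix of a string in `D`. -/
def CompleteDict {A : Type*} (D : Set (List A)) : Prop :=
  PrefixFree D ∧ ∀ z : List A, (∃ x ∈ D, x <+: z) ∨ (∃ y ∈ D, z <+: y)

/-- `D ∩ A^n` as a finset. -/
noncomputable def dictAt {A : Type*} [Fintype A] [DecidableEq A]
    (D : Set (List A)) (n : ℕ) : Finset (List A) :=
  sfilter (fun x => x ∈ D) (lists A n)

/-- The failure set at level `n`: strings of length `n` with no prefix in `D`. -/
noncomputable def failAt {A : Type*} [Fintype A] [DecidableEq A]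
    (D : Set (List A)) (n : ℕ) : Finset (List A) :=
  sfilter (fun x => ¬ ∃ y ∈ D, y <+: x) (lists A n)

/-- The failure part of a finite set `T` of strings: members with no prefix in `D`. -/
noncomputable def failIn {A : Type*} (D : Set (List A)) (T : Finset (List A)) :
    Finset (List A) :=
  sfilter (fun x => ¬ ∃ y ∈ D, y <+: x) T

/-- The VFR `(D, ξ, M)` is perfect for the process `p` (at every level `n`,
equivalently at every truncation level): conditioned on `X^n ∈ D ∩ A^n`
(whenever nonempty), `ξ(X^n)` is uniform on `{0, …, M−1}`. -/
def PerfectVFR {A : Type*} [Fintype A] [DecidableEq A] [Inhabited A] (k : ℕ)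
    (s0 : Fin k → A) (p : (Fin k → A) → A → ℝ) (D : Set (List A))
    (ξ : List A → ℕ) (M : ℕ) : Prop :=
  ∀ n : ℕ, (dictAt (A := A) D n).Nonempty →
    ∀ r < M,
      (∑ x ∈ sfilter (fun x => ξ x = r) (dictAt (A := A) D n), seqProbL k s0 p x)
        = (∑ x ∈ dictAt (A := A) D n, seqProbL k s0 p x) / (M : ℝ)

/-- Failure probability at truncation level `N`. -/
noncomputable def pFail {A : Type*} [Fintype A] [DecidableEq A] [Inhabited A] (k : ℕ)
    (s0 : Fin k → A) (p : (Fin k → A) → A → ℝ) (D : Set (List A)) (N : ℕ) : ℝ :=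
  ∑ x ∈ failAt (A := A) D N, seqProbL k s0 p x

theorem mem_sfilter {α : Type*} {p : α → Prop} {s : Finset α} {x : α} :
    x ∈ sfilter p s ↔ x ∈ s ∧ p x := by
  simp [sfilter]

theorem mem_lists {A : Type*} [Fintype A] [DecidableEq A] {n : ℕ} {x : List A} :
    x ∈ lists A n ↔ x.length = n := by
  induction n generalizing x with
  | zero => simp [lists]
  | succ n ih => cases x <;> simp [lists, ih]

theorem countL_le_length {A : Type*} [Inhabited A] [DecidableEq A] (k : ℕ)
    (s0 s : Fin k → A) (a : A) (x : List A) : countL k s0 s a x ≤ x.length := by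
  unfold countL sfilter
  exact (@card_filter_le _ _ _ (Classical.decPred _)).trans (by simp)

/-- A strictly positive kernel on an alphabet with at least two letters has all its transition
probabilities bounded by a constant less than one. -/
theorem IsMarkov.exists_lt_one {A : Type*} [Fintype A] (hA : 2 ≤ Fintype.card A) {k : ℕ}
    {p : (Fin k → A) → A → ℝ} (hp : IsMarkov k p) :
    ∃ q : ℝ, 0 < q ∧ q < 1 ∧ ∀ s a, p s a ≤ q := by
  classical
  have : Nontrivial A := Fintype.one_lt_card_iff_nontrivial.1 hA
  obtain ⟨⟨s, a⟩, h⟩ := Finite.exists_max fun z : (Fin k → A) × A => p z.1 z.2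
  refine ⟨p s a, hp.1 s a, ?_, fun t b => h (t, b)⟩
  obtain ⟨b, hb⟩ := exists_ne a
  rw [← hp.2 s]
  exact single_lt_sum hb (mem_univ a) (mem_univ b) (hp.1 s b) fun c _ _ => (hp.1 s c).le

theorem seqProbL_le_pow {A : Type*} [Inhabited A] {k : ℕ} (s0 : Fin k → A)
    {p : (Fin k → A) → A → ℝ} {q : ℝ} (hp : ∀ s a, 0 ≤ p s a) (hq : ∀ s a, p s a ≤ q)
    (x : List A) : seqProbL k s0 p x ≤ q ^ x.length := by
  calc seqProbL k s0 p x ≤ ∏ _t : Fin x.length, q :=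
        prod_le_prod (fun _ _ => hp _ _) fun _ _ => hq _ _
    _ = q ^ x.length := by simp

/-- If every type class of length-`n` strings has at most `m` failures, the total number of
failures is at most `m` times the polynomial bound on the number of types. -/
theorem card_failAt_le {A : Type*} [Fintype A] [DecidableEq A] [Inhabited A] {k : ℕ}
    (s0 : Fin k → A) (D : Set (List A)) {n m : ℕ}
    (h : ∀ x ∈ lists A n, (failIn D (typeClassL k s0 x)).card ≤ m) :
    (failAt D n).card ≤ m * (n + 1) ^ Fintype.card ((Fin k → A) × A) := by
  let f : List A → ((Fin k → A) × A → Fin (n + 1)) :=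
    fun x z => Fin.ofNat (n + 1) (countL k s0 z.1 z.2 x)
  have hf : ∀ x ∈ lists A n, ∀ z, (f x z : ℕ) = countL k s0 z.1 z.2 x := fun x hx z =>
    Nat.mod_eq_of_lt (Nat.lt_succ_of_le (mem_lists.1 hx ▸ countL_le_length k s0 z.1 z.2 x))
  have key := card_le_mul_card_image_of_maps_to (f := f) (s := failAt D n) (t := univ)
    (fun _ _ => mem_univ _) m fun c _ => by
      rcases (filter (fun x => f x = c) (failAt D n)).eq_empty_or_nonempty with he | ⟨x, hx⟩
      · simp [he]
      · obtain ⟨hxF, rfl⟩ := mem_filter.1 hx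
        have hxL := (mem_sfilter.1 hxF).1
        refine (card_le_card fun y hy => ?_).trans (h x hxL)
        obtain ⟨hyF, hyx⟩ := mem_filter.1 hy
        obtain ⟨hyL, hyD⟩ := mem_sfilter.1 hyF
        refine mem_sfilter.2 ⟨mem_sfilter.2 ⟨?_, ?_, fun s a => ?_⟩, hyD⟩
        · rwa [mem_lists.1 hxL]
        · rw [mem_lists.1 hxL, mem_lists.1 hyL]
        · rw [← hf x hxL (s, a), ← hf y hyL (s, a), hyx]
  simpa using key

theorem exists_pow_mul_pow_le (K : ℕ) {q : ℝ} (hq : 0 < q) (hq1 : q < 1) :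
    ∃ C : ℝ, 0 < C ∧ ∃ ρ : ℝ, 0 < ρ ∧ ρ < 1 ∧
      ∀ n : ℕ, ((n : ℝ) + 1) ^ K * q ^ n ≤ C * ρ ^ n := by
  obtain ⟨ρ, hqρ, hρ1⟩ := exists_between hq1
  have hρ : 0 < ρ := hq.trans hqρ
  have hr : 0 < q / ρ := div_pos hq hρ
  have ht := tendsto_pow_const_mul_const_pow_of_abs_lt_one K
    (r := q / ρ) (by rw [abs_of_pos hr]; exact (div_lt_one hρ).2 hqρ)
  obtain ⟨B, hB⟩ := ht.bddAbove_range
  have hB' : ∀ n : ℕ, ((n : ℝ) + 1) ^ K * (q / ρ) ^ (n + 1) ≤ B := fun n => by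
    simpa using hB ⟨n + 1, rfl⟩
  have hB0 : 0 < B := lt_of_lt_of_le (by positivity) (hB' 0)
  refine ⟨B / (q / ρ), div_pos hB0 hr, ρ, hρ, hρ1, fun n => ?_⟩
  have h : ((n : ℝ) + 1) ^ K * (q / ρ) ^ n ≤ B / (q / ρ) := by
    rw [le_div_iff₀ hr, mul_assoc, ← pow_succ]
    exact hB' n
  have := mul_le_mul_of_nonneg_right h (pow_pos hρ n).le
  rwa [mul_assoc, ← mul_pow, div_mul_cancel₀ _ hρ.ne'] at this

/-- For the greedy dictionary `D*` (complete, with `M ∣ |D*(T)|`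
and `|fail*_n(T)| = |T| mod M` for every type class `T`), the failure probability
decays exponentially fast with the truncation level `N`, for every `P ∈ P_k`. -/
theorem greedy_failure_prob_exponential_decay {A : Type*} [Fintype A] [DecidableEq A]
    [Inhabited A] (hA : 2 ≤ Fintype.card A) (k : ℕ) (s0 : Fin k → A)
    (M : ℕ) (hM : 2 ≤ M)
    (Ds : Set (List A)) (hDs : CompleteDict Ds)
    (hdivs : ∀ n : ℕ, 1 ≤ n → ∀ x ∈ lists A n,
      M ∣ (sfilter (fun y => y ∈ Ds) (typeClassL k s0 x)).card)
    (hfails : ∀ n : ℕ, 1 ≤ n → ∀ x ∈ lists A n,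
      (failIn Ds (typeClassL k s0 x)).card = (typeClassL k s0 x).card % M)
    (p : (Fin k → A) → A → ℝ) (hp : IsMarkov k p) :
    ∃ C : ℝ, 0 < C ∧ ∃ ρ : ℝ, 0 < ρ ∧ ρ < 1 ∧
      ∀ N : ℕ, 1 ≤ N → pFail k s0 p Ds N ≤ C * ρ ^ N := by
  obtain ⟨q, hq, hq1, hpq⟩ := hp.exists_lt_one hA
  obtain ⟨C, hC, ρ, hρ, hρ1, h⟩ :=
    exists_pow_mul_pow_le (Fintype.card ((Fin k → A) × A)) hq hq1
  have hM0 : 0 < M := by lia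
  refine ⟨M * C, by positivity, ρ, hρ, hρ1, fun N hN => ?_⟩
  have hcard := card_failAt_le s0 Ds (n := N) (m := M) fun x hx =>
    (hfails N hN x hx).trans_le (Nat.mod_lt _ hM0).le
  calc pFail k s0 p Ds N ≤ ∑ _x ∈ failAt Ds N, q ^ N := sum_le_sum fun x hx => by
        have hx' := seqProbL_le_pow s0 (fun s a => (hp.1 s a).le) hpq x
        rwa [mem_lists.1 (mem_sfilter.1 hx).1] at hx'
    _ = (failAt Ds N).card * q ^ N := by simp
    _ ≤ (M * ((N : ℝ) + 1) ^ Fintype.card ((Fin k → A) × A)) * q ^ N := by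
        gcongr
        exact_mod_cast hcard
    _ ≤ M * C * ρ ^ N := by
        rw [mul_assoc, mul_assoc]
        exact mul_le_mul_of_nonneg_left (h N) (Nat.cast_nonneg M)
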